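/- For every q ≥ 0 there exists a constant C ≥ 1 such that for all vertices i, j ∈ V and all m ∈ ℕ, D̂_m^q(μ_i) ≤ C · D̂_m^q(μ_j); in particular the constant C does not depend on m. -/

import Mathlib

open MeasureTheory Filter Set

noncomputable section

/-- The lower `L^q`-spectrum of a measure. -/
def lowerLq {X : Type*} [MeasurableSpace X] [PseudoMetricSpace X] (ν : Measure X) (q : ℝ) : ℝ :=
  liminf (fun δ : ℝ =>
      Real.log (∫ x, (ν (Metric.ball x δ)).toReal ^ (q - 1) ∂ν) / (-Real.log δ))
    (nhdsWithin 0 (Set.Ioi 0))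

/-- The upper `L^q`-spectrum of a measure. -/
def upperLq {X : Type*} [MeasurableSpace X] [PseudoMetricSpace X] (ν : Measure X) (q : ℝ) : ℝ :=
  limsup (fun δ : ℝ =>
      Real.log (∫ x, (ν (Metric.ball x δ)).toReal ^ (q - 1) ∂ν) / (-Real.log δ))
    (nhdsWithin 0 (Set.Ioi 0))

/-- The closed dyadic cube of side `2^{-n}` indexed by `k ∈ ℤ^d` of the mesh anchored at the
origin. -/
def dyadicCube (d n : ℕ) (k : Fin d → ℤ) : Set (EuclideanSpace ℝ (Fin d)) :=
  {x | ∀ i, (k i : ℝ) * (2 : ℝ) ^ (-(n : ℤ)) ≤ x i ∧ x i ≤ ((k i : ℝ) + 1) * (2 : ℝ) ^ (-(n : ℤ))}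

/-- `D̂_n^q(ν) = ∑_{Q ∈ D̂_n} ν(Q)^q` with the convention `0^0 = 0`. -/
def dyadicSum {d : ℕ} (ν : Measure (EuclideanSpace ℝ (Fin d))) (q : ℝ) (n : ℕ) : ℝ :=
  ∑' k : Fin d → ℤ,
    if ν (dyadicCube d n k) = 0 then 0 else (ν (dyadicCube d n k)).toReal ^ q

/-- `0^0 = 0` power on `ENNReal`. -/
def gpow (q : ℝ) (a : ENNReal) : ENNReal := if a = 0 then 0 else a ^ q

lemma gpow_mono {q : ℝ} (hq : 0 ≤ q) {a b : ENNReal} (h : a ≤ b) : gpow q a ≤ gpow q b := by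
  unfold gpow
  split_ifs with h1 h2 h2
  · exact le_rfl
  · exact zero_le
  · subst h2; exact absurd (le_zero_iff.mp h) h1
  · exact ENNReal.rpow_le_rpow h hq

lemma gpow_mul_le {q : ℝ} (hq : 0 ≤ q) (A a : ENNReal) :
    gpow q (A * a) ≤ A ^ q * gpow q a := by
  unfold gpow
  split_ifs with h1 h2 h2
  · exact zero_le
  · exact zero_le
  · subst h2; simp at h1
  · rw [ENNReal.mul_rpow_of_nonneg _ _ hq]

lemma gpow_sum_le {q : ℝ} (hq : 0 ≤ q) {ι : Type*} (T : Finset ι) (a : ι → ENNReal) :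
    gpow q (∑ k ∈ T, a k) ≤ (T.card : ENNReal) ^ q * ∑ k ∈ T, gpow q (a k) := by
  rcases T.eq_empty_or_nonempty with rfl | hT
  · simp [gpow]
  · obtain ⟨k0, hk0, hmax⟩ := T.exists_max_image a hT
    calc gpow q (∑ k ∈ T, a k) ≤ gpow q ((T.card : ENNReal) * a k0) := by
          apply gpow_mono hq
          calc ∑ k ∈ T, a k ≤ ∑ k ∈ T, a k0 := Finset.sum_le_sum hmax
            _ = _ := by simp
      _ ≤ (T.card : ENNReal) ^ q * gpow q (a k0) := gpow_mul_le hq _ _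
      _ ≤ _ := by
          gcongr
          exact Finset.single_le_sum (f := fun k => gpow q (a k)) (fun _ _ => zero_le) hk0

lemma card_bound {d : ℕ} (R : ℕ) (T : Set (Fin d → ℤ))
    (h : ∀ k ∈ T, ∀ l ∈ T, ∀ i, |(k i : ℝ) - l i| ≤ R) :
    ∃ F : Finset (Fin d → ℤ), (∀ k, k ∈ F ↔ k ∈ T) ∧ F.card ≤ (2 * R + 1) ^ d := by
  classical
  rcases T.eq_empty_or_nonempty with rfl | ⟨k0, hk0⟩
  · exact ⟨∅, by simp, by simp⟩
  · refine ⟨(Finset.Icc (fun i => k0 i - R) (fun i => k0 i + R)).filter (· ∈ T), ?_, ?_⟩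
    · intro k
      simp only [Finset.mem_filter, Finset.mem_Icc, and_iff_right_iff_imp]
      intro hk
      have : ∀ i, |k i - k0 i| ≤ (R : ℤ) := fun i => by
        have := h k hk k0 hk0 i
        exact_mod_cast this
      constructor
      · intro i
        have := abs_le.mp (this i)
        show k0 i - R ≤ k i
        linarith
      · intro i
        have := abs_le.mp (this i)
        show k i ≤ k0 i + R
        linarith
    · refine (Finset.card_filter_le _ _).trans ?_
      rw [Pi.card_Icc]
      simp only [Int.card_Icc]
      have : ∀ i, (k0 i + (R:ℤ) + 1 - (k0 i - R)).toNat = 2 * R + 1 := fun i => by omega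
      simp [this]

lemma coord_le_dist {d : ℕ} (x y : EuclideanSpace ℝ (Fin d)) (i : Fin d) :
    |x i - y i| ≤ dist x y := by
  rw [EuclideanSpace.dist_eq]
  have h : |x i - y i| = Real.sqrt (dist (x i) (y i) ^ 2) := by
    rw [Real.sqrt_sq dist_nonneg, Real.dist_eq]
  rw [h]
  apply Real.sqrt_le_sqrt
  exact Finset.single_le_sum (f := fun i => dist (x i) (y i) ^ 2)
    (fun _ _ => sq_nonneg _) (Finset.mem_univ i)

lemma cube_diam {d n : ℕ} {k : Fin d → ℤ} {x y : EuclideanSpace ℝ (Fin d)}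
    (hx : x ∈ dyadicCube d n k) (hy : y ∈ dyadicCube d n k) :
    dist x y ≤ Real.sqrt d * (2 : ℝ) ^ (-(n : ℤ)) := by
  have hpos : (0:ℝ) < (2 : ℝ) ^ (-(n : ℤ)) := by positivity
  rw [EuclideanSpace.dist_eq]
  have : Real.sqrt d * (2 : ℝ) ^ (-(n : ℤ)) = Real.sqrt (d * ((2 : ℝ) ^ (-(n : ℤ))) ^ 2) := by
    rw [Real.sqrt_mul (by positivity), Real.sqrt_sq hpos.le]
  rw [this]
  apply Real.sqrt_le_sqrt
  calc _ ≤ ∑ i : Fin d, ((2 : ℝ) ^ (-(n : ℤ))) ^ 2 := by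
        apply Finset.sum_le_sum
        intro i _
        apply pow_le_pow_left₀ dist_nonneg
        rw [Real.dist_eq, abs_le]
        have h1 := hx i
        have h2 := hy i
        constructor <;> linarith
    _ = _ := by simp

lemma index_close {d n : ℕ} {k l : Fin d → ℤ} {x y : EuclideanSpace ℝ (Fin d)} {r : ℝ}
    (hx : x ∈ dyadicCube d n k) (hy : y ∈ dyadicCube d n l)
    (h : dist x y ≤ r * (2 : ℝ) ^ (-(n : ℤ))) (i : Fin d) :
    |(k i : ℝ) - l i| ≤ (⌈r⌉₊ + 1 : ℕ) := by
  have hpos : (0:ℝ) < (2 : ℝ) ^ (-(n : ℤ)) := by positivity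
  have h0 := abs_le.mp ((coord_le_dist x y i).trans h)
  have h1 := hx i
  have h2 := hy i
  have h3 : |(k i : ℝ) - l i| ≤ r + 1 := by
    rw [abs_le]
    constructor
    · apply le_of_mul_le_mul_right _ hpos
      linarith
    · apply le_of_mul_le_mul_right _ hpos
      linarith
  push_cast
  linarith [Nat.le_ceil r]

lemma mem_some_cube {d : ℕ} (n : ℕ) (x : EuclideanSpace ℝ (Fin d)) :
    ∃ k, x ∈ dyadicCube d n k := by
  have hpos : (0:ℝ) < (2 : ℝ) ^ (-(n : ℤ)) := by positivity
  refine ⟨fun i => ⌊x i / (2 : ℝ) ^ (-(n : ℤ))⌋, fun i => ⟨?_, ?_⟩⟩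
  · rw [← le_div_iff₀ hpos]; exact Int.floor_le _
  · rw [← div_le_iff₀ hpos]; exact (Int.lt_floor_add_one _).le

/-- ENNReal version of the dyadic sum. -/
def eSum {d : ℕ} (ν : Measure (EuclideanSpace ℝ (Fin d))) (q : ℝ) (n : ℕ) : ENNReal :=
  ∑' k : Fin d → ℤ, gpow q (ν (dyadicCube d n k))

lemma gpow_ne_top {q : ℝ} (hq : 0 ≤ q) {a : ENNReal} (h : a ≠ ⊤) : gpow q a ≠ ⊤ := by
  unfold gpow
  split_ifs
  · simp
  · exact ENNReal.rpow_ne_top_of_nonneg hq h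

lemma dyadicSum_eq {d : ℕ} (ν : Measure (EuclideanSpace ℝ (Fin d))) [IsFiniteMeasure ν]
    {q : ℝ} (hq : 0 ≤ q) (n : ℕ) : dyadicSum ν q n = (eSum ν q n).toReal := by
  unfold eSum dyadicSum
  rw [ENNReal.tsum_toReal_eq (fun k => gpow_ne_top hq (measure_ne_top _ _))]
  congr 1
  ext k
  unfold gpow
  split_ifs
  · simp
  · rw [ENNReal.toReal_rpow]

lemma eSum_ne_top {d : ℕ} (ν : Measure (EuclideanSpace ℝ (Fin d))) [IsFiniteMeasure ν]
    {q : ℝ} (hq : 0 ≤ q) (n : ℕ) (h : ∃ K : Set (EuclideanSpace ℝ (Fin d)), IsCompact K ∧ ν Kᶜ = 0) :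
    eSum ν q n ≠ ⊤ := by
  obtain ⟨K, hK, hνK⟩ := h
  have hpos : (0:ℝ) < (2 : ℝ) ^ (-(n : ℤ)) := by positivity
  obtain ⟨C, hC⟩ := Metric.isBounded_iff.mp hK.isBounded
  obtain ⟨F, hF, -⟩ := card_bound (⌈C / (2 : ℝ) ^ (-(n : ℤ))⌉₊ + 1)
    {k : Fin d → ℤ | (dyadicCube d n k ∩ K).Nonempty} (by
      rintro k ⟨x, hx, hxK⟩ l ⟨y, hy, hyK⟩ i
      refine index_close hx hy ?_ i
      rw [div_mul_cancel₀ _ hpos.ne']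
      exact hC hxK hyK)
  unfold eSum
  rw [tsum_eq_sum (s := F)]
  · rw [ENNReal.sum_ne_top]
    intro k _
    exact gpow_ne_top hq (measure_ne_top _ _)
  · intro k hk
    have : ν (dyadicCube d n k) = 0 := by
      apply measure_mono_null _ hνK
      intro x hx hxK
      exact hk ((hF k).2 ⟨x, hx, hxK⟩)
    simp [gpow, this]

lemma edge_bound {d : ℕ} (ν μ : Measure (EuclideanSpace ℝ (Fin d)))
    (S : EuclideanSpace ℝ (Fin d) → EuclideanSpace ℝ (Fin d)) (c : ℝ) (hc0 : 0 < c)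
    (hS : ∀ x y, dist (S x) (S y) = c * dist x y)
    (P : ENNReal) (hP0 : P ≠ 0) (hPt : P ≠ ⊤)
    (h : ∀ A, P * ν (S ⁻¹' A) ≤ μ A) {q : ℝ} (hq : 0 ≤ q) :
    ∃ C : ENNReal, C ≠ ⊤ ∧ ∀ n, eSum ν q n ≤ C * eSum μ q n := by
  classical
  set M : ℕ := (2 * (⌈c * Real.sqrt d⌉₊ + 1) + 1) ^ d with hM
  set M' : ℕ := (2 * (⌈Real.sqrt d / c⌉₊ + 1) + 1) ^ d with hM'
  refine ⟨(P⁻¹) ^ q * (M : ENNReal) ^ q * M', ?_, ?_⟩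
  · refine ENNReal.mul_ne_top (ENNReal.mul_ne_top ?_ ?_) (by simp)
    · exact ENNReal.rpow_ne_top_of_nonneg hq (by simpa using hP0)
    · exact ENNReal.rpow_ne_top_of_nonneg hq (by simp)
  intro n
  let r : (Fin d → ℤ) → (Fin d → ℤ) → Prop :=
    fun k l => ∃ x, x ∈ dyadicCube d n k ∧ S x ∈ dyadicCube d n l
  have h1 : ∀ k, ∃ F : Finset (Fin d → ℤ), (∀ l, l ∈ F ↔ l ∈ {l | r k l}) ∧ F.card ≤ M := by
    intro k
    apply card_bound
    rintro l ⟨x, hx, hSx⟩ l' ⟨y, hy, hSy⟩ i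
    refine index_close hSx hSy ?_ i
    rw [hS, mul_assoc]
    exact mul_le_mul_of_nonneg_left (cube_diam hx hy) hc0.le
  have h2 : ∀ l, ∃ F : Finset (Fin d → ℤ), (∀ k, k ∈ F ↔ k ∈ {k | r k l}) ∧ F.card ≤ M' := by
    intro l
    apply card_bound
    rintro k ⟨x, hx, hSx⟩ k' ⟨y, hy, hSy⟩ i
    refine index_close hx hy ?_ i
    have := cube_diam hSx hSy
    rw [hS] at this
    rw [div_mul_eq_mul_div, le_div_iff₀ hc0]
    linarith
  choose F hF hFc using h1
  choose G hG hGc using h2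
  have hν : ∀ k, ν (dyadicCube d n k) ≤ P⁻¹ * ∑ l ∈ F k, μ (dyadicCube d n l) := by
    intro k
    calc ν (dyadicCube d n k) ≤ ν (⋃ l ∈ F k, S ⁻¹' dyadicCube d n l) := by
          apply measure_mono
          intro x hx
          obtain ⟨l, hl⟩ := mem_some_cube n (S x)
          simp only [mem_iUnion]
          exact ⟨l, (hF k l).2 ⟨x, hx, hl⟩, hl⟩
      _ ≤ ∑ l ∈ F k, ν (S ⁻¹' dyadicCube d n l) := measure_biUnion_finset_le _ _
      _ ≤ ∑ l ∈ F k, P⁻¹ * μ (dyadicCube d n l) := by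
          apply Finset.sum_le_sum
          intro l _
          calc _ = P⁻¹ * (P * ν (S ⁻¹' dyadicCube d n l)) := by
                rw [← mul_assoc, ENNReal.inv_mul_cancel hP0 hPt, one_mul]
            _ ≤ _ := by gcongr; exact h _
      _ = _ := by rw [Finset.mul_sum]
  set B := (P⁻¹) ^ q * (M : ENNReal) ^ q
  have hk : ∀ k, gpow q (ν (dyadicCube d n k)) ≤
      B * ∑' l, if r k l then gpow q (μ (dyadicCube d n l)) else 0 := by
    intro k
    calc _ ≤ gpow q (P⁻¹ * ∑ l ∈ F k, μ (dyadicCube d n l)) := gpow_mono hq (hν k)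
      _ ≤ (P⁻¹) ^ q * gpow q (∑ l ∈ F k, μ (dyadicCube d n l)) := gpow_mul_le hq _ _
      _ ≤ (P⁻¹) ^ q * (((F k).card : ENNReal) ^ q * ∑ l ∈ F k, gpow q (μ (dyadicCube d n l))) := by
          gcongr; exact gpow_sum_le hq _ _
      _ ≤ (P⁻¹) ^ q * ((M : ENNReal) ^ q * ∑ l ∈ F k, gpow q (μ (dyadicCube d n l))) := by
          gcongr; exact hFc k
      _ = B * ∑ l ∈ F k, gpow q (μ (dyadicCube d n l)) := by rw [mul_assoc]
      _ = B * ∑ l ∈ F k, if r k l then gpow q (μ (dyadicCube d n l)) else 0 := by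
          congr 1
          apply Finset.sum_congr rfl
          intro l hl
          have hr : r k l := (hF k l).1 hl
          rw [if_pos hr]
      _ ≤ _ := by gcongr; exact ENNReal.sum_le_tsum _
  unfold eSum
  calc _ ≤ ∑' k, B * ∑' l, if r k l then gpow q (μ (dyadicCube d n l)) else 0 :=
        ENNReal.tsum_le_tsum hk
    _ = B * ∑' l, ∑' k, if r k l then gpow q (μ (dyadicCube d n l)) else 0 := by
        rw [ENNReal.tsum_mul_left, ENNReal.tsum_comm]
    _ ≤ B * ∑' l, M' * gpow q (μ (dyadicCube d n l)) := by
        gcongr with l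
        rw [tsum_eq_sum (s := G l)]
        · calc _ ≤ ∑ k ∈ G l, gpow q (μ (dyadicCube d n l)) := by
                apply Finset.sum_le_sum
                intro k _
                split_ifs <;> simp
            _ = (G l).card * gpow q (μ (dyadicCube d n l)) := by simp
            _ ≤ _ := by gcongr; exact hGc l
        · intro k hk
          have hr : ¬ r k l := fun hr => hk ((hG l k).2 hr)
          rw [if_neg hr]
    _ = _ := by rw [ENNReal.tsum_mul_left, ← mul_assoc]

/-- **Lemma.** For graph-directed self-similar measures `(μ i)_{i ∈ V}` and `q ≥ 0`, the dyadic
moment sums `D̂_m^q(μ i)` and `D̂_m^q(μ j)` are comparable, with a constant independent of `m`. -/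
theorem dyadic_moment_sums_comparable_for_graph_directed_measures
    {d : ℕ} {V E : Type} [Fintype V] [Fintype E] [Nonempty V] [DecidableEq V]
    (src dst : E → V)
    (hconn : ∀ i j : V, Relation.ReflTransGen (fun a b : V => ∃ e, src e = a ∧ dst e = b) i j)
    (S : E → EuclideanSpace ℝ (Fin d) → EuclideanSpace ℝ (Fin d))
    (c : E → ℝ) (hc : ∀ e, c e ∈ Set.Ioo (0 : ℝ) 1)
    (hS : ∀ e x y, dist (S e x) (S e y) = c e * dist x y)
    (p : E → ℝ) (hp : ∀ e, p e ∈ Set.Ioo (0 : ℝ) 1)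
    (hpsum : ∀ i : V, ∑ e ∈ Finset.univ.filter fun e => src e = i, p e = 1)
    (μ : V → Measure (EuclideanSpace ℝ (Fin d)))
    (hprob : ∀ i, IsProbabilityMeasure (μ i))
    (hcpt : ∀ i, ∃ K : Set (EuclideanSpace ℝ (Fin d)), IsCompact K ∧ μ i Kᶜ = 0)
    (hμ : ∀ i : V, μ i =
      ∑ e ∈ Finset.univ.filter fun e => src e = i,
        ENNReal.ofReal (p e) • Measure.map (S e) (μ (dst e))) :
    ∀ q : ℝ, 0 ≤ q → ∃ C : ℝ, 1 ≤ C ∧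
      ∀ i j : V, ∀ m : ℕ, dyadicSum (μ i) q m ≤ C * dyadicSum (μ j) q m := by
  intro q hq
  have edge : ∀ e, ∃ C : ENNReal, C ≠ ⊤ ∧
      ∀ n, eSum (μ (dst e)) q n ≤ C * eSum (μ (src e)) q n := by
    intro e
    have hcont : Continuous (S e) :=
      (LipschitzWith.of_dist_le_mul (K := ⟨c e, (hc e).1.le⟩)
        (fun x y => (hS e x y).le)).continuous
    refine edge_bound _ _ (S e) (c e) (hc e).1 (hS e) (ENNReal.ofReal (p e))
      (by simpa using (hp e).1) ENNReal.ofReal_ne_top ?_ hq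
    intro A
    rw [hμ (src e), Measure.finsetSum_apply]
    calc _ ≤ ENNReal.ofReal (p e) * Measure.map (S e) (μ (dst e)) A := by
          refine mul_le_mul_right ?_ _
          exact Measure.le_map_apply hcont.measurable.aemeasurable A
      _ ≤ _ := by
          exact Finset.single_le_sum
            (f := fun e' => (ENNReal.ofReal (p e') • Measure.map (S e') (μ (dst e'))) A)
            (fun _ _ => zero_le) (by simp)
  have path : ∀ i j, ∃ C : ENNReal, C ≠ ⊤ ∧ ∀ n, eSum (μ i) q n ≤ C * eSum (μ j) q n := by
    intro i j
    induction hconn j i with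
    | refl => exact ⟨1, by simp, by simp⟩
    | tail _ h ih =>
      obtain ⟨C, hC, h1⟩ := ih
      obtain ⟨e, rfl, rfl⟩ := h
      obtain ⟨C', hC', h2⟩ := edge e
      refine ⟨C' * C, ENNReal.mul_ne_top hC' hC, fun n => (h2 n).trans ?_⟩
      rw [mul_assoc]
      gcongr
      exact h1 n
  choose C hC hCle using path
  refine ⟨1 + ∑ i, ∑ j, (C i j).toReal, ?_, ?_⟩
  · have : 0 ≤ ∑ i, ∑ j, (C i j).toReal :=
      Finset.sum_nonneg fun _ _ => Finset.sum_nonneg fun _ _ => ENNReal.toReal_nonneg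
    linarith
  intro i j m
  have := hprob i
  have := hprob j
  rw [dyadicSum_eq _ hq, dyadicSum_eq _ hq]
  have h1 := ENNReal.toReal_mono
    (ENNReal.mul_ne_top (hC i j) (eSum_ne_top (μ j) hq m (hcpt j))) (hCle i j m)
  rw [ENNReal.toReal_mul] at h1
  refine h1.trans ?_
  apply mul_le_mul_of_nonneg_right _ ENNReal.toReal_nonneg
  have h2 : (C i j).toReal ≤ ∑ j, (C i j).toReal :=
    Finset.single_le_sum (f := fun j => (C i j).toReal)
      (fun _ _ => ENNReal.toReal_nonneg) (Finset.mem_univ j)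
  have h3 : ∑ j, (C i j).toReal ≤ ∑ i, ∑ j, (C i j).toReal :=
    Finset.single_le_sum (f := fun i => ∑ j, (C i j).toReal)
      (fun _ _ => Finset.sum_nonneg fun _ _ => ENNReal.toReal_nonneg) (Finset.mem_univ i)
  linarith
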